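/- arXiv:2211.11846 — 3 statements merged into one kernel-verified Lean document; each statement's English description precedes it below -/
import Mathlib

section
/- For every real p ∈ [1,2], every integer d ≥ 1, every real w > 0, and all points x, y ∈ ℝ^d with ‖x − y‖_p ≤ w/(4d), one has vol(B_p(x,w) ∩ B_p(y,w)) / vol(B_p(x,w) ∪ B_p(y,w)) ≥ 1 − 4d·‖x − y‖_p/w. -/
open MeasureTheory

/-- The `ℓ_p` distance on `ℝ^d`: `‖x - y‖_p = (∑ i, |x i - y i| ^ p) ^ (1/p)`. -/
noncomputable def lpDist (p : ℝ) {d : ℕ} (x y : Fin d → ℝ) : ℝ :=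
  (∑ i, |x i - y i| ^ p) ^ (1 / p)

/-- The closed `ℓ_p` ball of radius `r` around `x` in `ℝ^d`. -/
def lpBall (p : ℝ) {d : ℕ} (x : Fin d → ℝ) (r : ℝ) : Set (Fin d → ℝ) :=
  {y | lpDist p x y ≤ r}

theorem lpDist_comm (p : ℝ) {d : ℕ} (x y : Fin d → ℝ) : lpDist p x y = lpDist p y x := by
  simp only [lpDist, abs_sub_comm]

theorem lpDist_nonneg (p : ℝ) {d : ℕ} (x y : Fin d → ℝ) : 0 ≤ lpDist p x y := by
  unfold lpDist
  positivity

theorem lpDist_triangle {p : ℝ} (hp : 1 ≤ p) {d : ℕ} (x y z : Fin d → ℝ) :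
    lpDist p x z ≤ lpDist p x y + lpDist p y z := by
  have h := Real.Lp_add_le Finset.univ (fun i => x i - y i) (fun i => y i - z i) hp
  simpa [lpDist] using h

theorem lpDist_midpoint {p : ℝ} (hp : 1 ≤ p) {d : ℕ} (x y : Fin d → ℝ) :
    lpDist p x (fun i => (x i + y i) / 2) = lpDist p x y / 2 := by
  have hp0 : p ≠ 0 := by linarith
  have h (i : Fin d) :
      |x i - (x i + y i) / 2| ^ p = (1 / 2 : ℝ) ^ p * |x i - y i| ^ p := by
    rw [← Real.mul_rpow (by norm_num) (abs_nonneg _),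
      show x i - (x i + y i) / 2 = (1 / 2) * (x i - y i) by ring, abs_mul]
    norm_num
  simp only [lpDist, h]
  rw [← Finset.mul_sum, Real.mul_rpow (by positivity) (by positivity), ← Real.rpow_mul (by norm_num),
    mul_one_div_cancel hp0, Real.rpow_one]
  ring

theorem lpBall_subset_lpBall {p : ℝ} (hp : 1 ≤ p) {d : ℕ} {x y : Fin d → ℝ} {r s : ℝ}
    (h : lpDist p y x + r ≤ s) : lpBall p x r ⊆ lpBall p y s := fun z hz => by
  have hz : lpDist p x z ≤ r := hz
  exact (lpDist_triangle hp y x z).trans (by linarith)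

theorem volume_lpBall {p : ℝ} (hp : 1 ≤ p) {d : ℕ} (hd : 1 ≤ d) (x : Fin d → ℝ) (r : ℝ) :
    volume (lpBall p x r) = ENNReal.ofReal r ^ d *
      ENNReal.ofReal ((2 * Real.Gamma (1 / p + 1)) ^ d / Real.Gamma (d / p + 1)) := by
  have : Nonempty (Fin d) := ⟨⟨0, hd⟩⟩
  have h := volume_sum_rpow_le (Fin d) hp r
  rw [Fintype.card_fin] at h
  rw [← h, ← measure_preimage_add_right volume x]
  congr 1
  ext z
  simp [lpBall, lpDist]

/-- **Volume ratio of intersecting `ℓ_p` balls (close regime).**  For every `p ∈ [1,2]`,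
`d ≥ 1`, `w > 0` and points `x, y ∈ ℝ^d` with `‖x-y‖_p ≤ w/(4d)`, one has
`vol(B_p(x,w) ∩ B_p(y,w)) / vol(B_p(x,w) ∪ B_p(y,w)) ≥ 1 - 4d·‖x-y‖_p/w`. -/
theorem lp_ball_intersection_volume_ratio_close :
    ∀ p : ℝ, 1 ≤ p → p ≤ 2 →
      ∀ d : ℕ, 1 ≤ d → ∀ w : ℝ, 0 < w →
        ∀ x y : Fin d → ℝ, lpDist p x y ≤ w / (4 * d) →
          1 - 4 * d * lpDist p x y / w ≤
            (volume (lpBall p x w ∩ lpBall p y w)).toReal /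
              (volume (lpBall p x w ∪ lpBall p y w)).toReal := by
  intro p hp _ d hd w hw x y hxy
  set δ := lpDist p x y with hδ
  have hδ0 : 0 ≤ δ := lpDist_nonneg p x y
  have hd' : (1 : ℝ) ≤ d := by exact_mod_cast hd
  have hδw : δ ≤ w := hxy.trans (div_le_self hw.le (by linarith))
  set m : Fin d → ℝ := fun i => (x i + y i) / 2 with hm
  have hxm : lpDist p x m = δ / 2 := lpDist_midpoint hp x y
  have hym : lpDist p y m = δ / 2 := by
    rw [hδ, lpDist_comm p x y, ← lpDist_midpoint hp y x]
    simp only [hm, add_comm]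
  have hinter : lpBall p m (w - δ / 2) ⊆ lpBall p x w ∩ lpBall p y w :=
    Set.subset_inter (lpBall_subset_lpBall hp (by linarith)) (lpBall_subset_lpBall hp (by linarith))
  have hunion : lpBall p x w ∪ lpBall p y w ⊆ lpBall p m (w + δ / 2) :=
    Set.union_subset (lpBall_subset_lpBall hp (by rw [lpDist_comm]; linarith))
      (lpBall_subset_lpBall hp (by rw [lpDist_comm]; linarith))
  set C : ℝ := (2 * Real.Gamma (1 / p + 1)) ^ d / Real.Gamma (d / p + 1) with hC
  have hC0 : 0 < C := by
    have h1 : 0 < Real.Gamma (1 / p + 1) := Real.Gamma_pos_of_pos (by positivity)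
    have h2 : 0 < Real.Gamma (d / p + 1) := Real.Gamma_pos_of_pos (by positivity)
    positivity
  have hvol (z : Fin d → ℝ) {r : ℝ} (hr : 0 ≤ r) :
      (volume (lpBall p z r)).toReal = r ^ d * C := by
    rw [volume_lpBall hp hd, ENNReal.toReal_mul, ENNReal.toReal_pow, ENNReal.toReal_ofReal hr,
      ENNReal.toReal_ofReal hC0.le]
  have hfin (z : Fin d → ℝ) (r : ℝ) : volume (lpBall p z r) ≠ ⊤ := by
    rw [volume_lpBall hp hd]
    finiteness
  have hlow : (w - δ / 2) ^ d * C ≤ (volume (lpBall p x w ∩ lpBall p y w)).toReal := by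
    rw [← hvol m (by linarith)]
    exact ENNReal.toReal_mono (measure_ne_top_of_subset Set.inter_subset_left (hfin x w))
      (measure_mono hinter)
  have hup : (volume (lpBall p x w ∪ lpBall p y w)).toReal ≤ (w + δ / 2) ^ d * C := by
    rw [← hvol m (by linarith)]
    exact ENNReal.toReal_mono (hfin m _) (measure_mono hunion)
  have hpos : 0 < (volume (lpBall p x w ∪ lpBall p y w)).toReal := by
    refine lt_of_lt_of_le (b := w ^ d * C) (by positivity) ?_
    rw [← hvol x hw.le]
    exact ENNReal.toReal_mono (measure_ne_top_of_subset hunion (hfin m _))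
      (measure_mono Set.subset_union_left)
  have hs : 0 < w + δ / 2 := by linarith
  have hdiv : δ / (w + δ / 2) ≤ δ / w := by gcongr; linarith
  have hdiv1 : δ / (w + δ / 2) ≤ 1 := by rw [div_le_one hs]; linarith
  have hdw : 0 ≤ d * (δ / w) := by positivity
  calc 1 - 4 * d * δ / w = 1 - 4 * (d * (δ / w)) := by ring
    _ ≤ 1 - d * (δ / (w + δ / 2)) := by nlinarith
    _ = 1 + d * (-(δ / (w + δ / 2))) := by ring
    _ ≤ (1 + -(δ / (w + δ / 2))) ^ d := one_add_mul_le_pow (by linarith) d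
    _ = ((w - δ / 2) / (w + δ / 2)) ^ d := by congr 1; field_simp; ring
    _ = ((w - δ / 2) ^ d * C) / ((w + δ / 2) ^ d * C) := by
      rw [div_pow, mul_div_mul_right _ _ hC0.ne']
    _ ≤ _ := by gcongr
end

section
/- For every real p ∈ [1,2], every integer d ≥ 1, every real t > 3, and all points x, y ∈ ℝ^d with ‖x − y‖_p ≤ 1/t, the following set inclusion holds: B_p((x+y)/2, (1 − 3/(2t)^p)^{1/p}) ⊆ (B_p(x,1) ∩ B_p(y,1)) ∪ B_p(x, (1 − 4/(2t)^p)^{1/p}) ∪ B_p(y, (1 − 4/(2t)^p)^{1/p}). -/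
/-- A Clarkson-type inequality on the real line for exponents at most `2`. -/
theorem abs_add_rpow_add_abs_sub_rpow_le {p : ℝ} (hp : 0 ≤ p) (hp2 : p ≤ 2) (a b : ℝ) :
    |a + b| ^ p + |a - b| ^ p ≤ 2 * (|a| ^ p + |b| ^ p) := by
  have key (c : ℝ) : |c| ^ p = (c ^ 2) ^ (p / 2) := by
    rw [← sq_abs, ← Real.rpow_natCast, ← Real.rpow_mul (abs_nonneg c)]
    congr 1
    push_cast
    ring
  have hconc := (Real.concaveOn_rpow (p := p / 2) (by linarith) (by linarith)).2
    (Set.mem_Ici.2 (sq_nonneg (a + b))) (Set.mem_Ici.2 (sq_nonneg (a - b)))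
    (by norm_num : (0 : ℝ) ≤ 1 / 2) (by norm_num : (0 : ℝ) ≤ 1 / 2) (by norm_num)
  have hmid : (1 / 2 : ℝ) • (a + b) ^ 2 + (1 / 2 : ℝ) • (a - b) ^ 2 = a ^ 2 + b ^ 2 := by
    simp only [smul_eq_mul]
    ring
  have hsub := Real.rpow_add_le_add_rpow (sq_nonneg a) (sq_nonneg b)
    (by linarith : 0 ≤ p / 2) (by linarith)
  rw [hmid] at hconc
  simp only [smul_eq_mul] at hconc
  simp only [key]
  linarith

/-- Comparing an `ℓ_p` distance with a `p`-th root amounts to comparing `p`-th powers. -/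
theorem lpDist_le_rpow_iff {p : ℝ} (hp : 0 < p) {d : ℕ} (x y : Fin d → ℝ) {r : ℝ}
    (hr : 0 ≤ r) : lpDist p x y ≤ r ^ (1 / p) ↔ ∑ i, |x i - y i| ^ p ≤ r :=
  Real.rpow_le_rpow_iff (Finset.sum_nonneg fun _ _ => by positivity) hr (by positivity)

/-- **Ball inclusion for `ℓ_p` spaces.**  For every `p ∈ [1,2]`, `d ≥ 1`, `t > 3` and points
`x, y ∈ ℝ^d` with `‖x-y‖_p ≤ 1/t`:
`B_p((x+y)/2, (1 - 3/(2t)^p)^{1/p}) ⊆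
  (B_p(x,1) ∩ B_p(y,1)) ∪ B_p(x, (1 - 4/(2t)^p)^{1/p}) ∪ B_p(y, (1 - 4/(2t)^p)^{1/p})`. -/
theorem lp_ball_inclusion :
    ∀ p : ℝ, 1 ≤ p → p ≤ 2 →
      ∀ d : ℕ, 1 ≤ d →
        ∀ t : ℝ, 3 < t →
          ∀ x y : Fin d → ℝ, lpDist p x y ≤ 1 / t →
            lpBall p ((x + y) / 2) ((1 - 3 / (2 * t) ^ p) ^ (1 / p)) ⊆
              (lpBall p x 1 ∩ lpBall p y 1) ∪
                lpBall p x ((1 - 4 / (2 * t) ^ p) ^ (1 / p)) ∪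
                lpBall p y ((1 - 4 / (2 * t) ^ p) ^ (1 / p)) := by
  intro p hp hp2 d _ t ht x y hxy z hz
  have hp0 : 0 < p := by linarith
  have hbig : 6 ≤ (2 * t) ^ p :=
    calc (6 : ℝ) ≤ (2 * t) ^ (1 : ℝ) := by rw [Real.rpow_one]; linarith
      _ ≤ (2 * t) ^ p := Real.rpow_le_rpow_of_exponent_le (by linarith) hp
  have hε : 1 / (2 * t) ^ p ≤ 1 / 6 := one_div_le_one_div_of_le (by norm_num) hbig
  have h3 : 3 / (2 * t) ^ p = 3 * (1 / (2 * t) ^ p) := by ring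
  have h4 : 4 / (2 * t) ^ p = 4 * (1 / (2 * t) ^ p) := by ring
  have one_rpow : (1 : ℝ) = 1 ^ (1 / p) := (Real.one_rpow _).symm
  simp only [lpBall, Set.mem_ofPred_eq, Set.mem_union, Set.mem_inter_iff] at hz ⊢
  rw [lpDist_le_rpow_iff hp0 _ _ (by linarith)] at hz
  rw [lpDist_le_rpow_iff hp0 _ _ (by linarith), lpDist_le_rpow_iff hp0 _ _ (by linarith)]
  rw [one_rpow, lpDist_le_rpow_iff hp0 _ _ zero_le_one, lpDist_le_rpow_iff hp0 _ _ zero_le_one,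
    ← one_rpow]
  have hroot : (1 / t : ℝ) = ((1 / t) ^ p) ^ (1 / p) := by
    rw [← Real.rpow_mul (by positivity), mul_one_div_cancel hp0.ne', Real.rpow_one]
  rw [hroot, lpDist_le_rpow_iff hp0 _ _ (by positivity)] at hxy
  have hhalf : ∑ i, |(x i - y i) / 2| ^ p ≤ 1 / (2 * t) ^ p := by
    have hterm (i : Fin d) : |(x i - y i) / 2| ^ p = |x i - y i| ^ p / 2 ^ p := by
      rw [abs_div, abs_two, Real.div_rpow (abs_nonneg _) zero_le_two]
    simp only [hterm]
    rw [← Finset.sum_div, div_le_iff₀ (by positivity)]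
    refine hxy.trans_eq ?_
    rw [Real.mul_rpow zero_le_two (by linarith), Real.div_rpow zero_le_one (by linarith),
      Real.one_rpow]
    field_simp
  have hsum : ∑ i, |x i - z i| ^ p + ∑ i, |y i - z i| ^ p ≤
      2 * (∑ i, |((x + y) / 2) i - z i| ^ p + ∑ i, |(x i - y i) / 2| ^ p) := by
    rw [← Finset.sum_add_distrib, ← Finset.sum_add_distrib, Finset.mul_sum]
    refine Finset.sum_le_sum fun i _ => ?_
    have hmid : ((x + y) / 2) i = (x i + y i) / 2 := rfl
    have h := abs_add_rpow_add_abs_sub_rpow_le hp0.le hp2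
      ((x i + y i) / 2 - z i) ((x i - y i) / 2)
    have hadd : (x i + y i) / 2 - z i + (x i - y i) / 2 = x i - z i := by ring
    have hsub : (x i + y i) / 2 - z i - (x i - y i) / 2 = y i - z i := by ring
    rwa [hadd, hsub, ← hmid] at h
  by_cases hx : ∑ i, |x i - z i| ^ p ≤ 1
  · by_cases hy : ∑ i, |y i - z i| ^ p ≤ 1
    · exact Or.inl (Or.inl ⟨hx, hy⟩)
    · exact Or.inl (Or.inr (by linarith))
  · exact Or.inr (by linarith)
end

section
/- There exists a universal constant C > 0 with the following property. Let (X,d_X) be a finite metric space with n points admitting a (τ,ρ)-triangle-LSO. Then there is a set H of unordered pairs of points of X with |H| ≤ C·n·τ·(1 + log n) such that for every x,y ∈ X there exists z ∈ X with d_X(x,z) + d_X(z,y) ≤ 2ρ·d_X(x,y), where each of the pairs {x,z} and {z,y} is either degenerate (its two points coincide) or belongs to H. (In particular H is a 2-hop 2ρ-spanner of X.) -/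
/-- A `(τ, ρ)`-triangle-LSO for the distance function `dX` on `X`. -/
def IsTriangleLSO {X : Type*} (dX : X → X → ℝ) (τ ρ : ℝ) : Prop :=
  ∃ (m : ℕ) (σ : Fin m → X → X → Prop),
    (m : ℝ) ≤ τ ∧ (∀ i, IsLinearOrder X (σ i)) ∧
    ∀ x y : X, ∃ i : Fin m,
      (σ i x y ∧ ∀ a b : X, σ i x a → σ i a b → σ i b y → dX a b ≤ ρ * dX x y) ∨
      (σ i y x ∧ ∀ a b : X, σ i y a → σ i a b → σ i b x → dX a b ≤ ρ * dX x y)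

/-- A finite set with fewer than `2 * N` elements has an element with fewer than `N` elements
of the set strictly on either side. -/
theorem exists_median {X : Type*} [LinearOrder X] (S : Finset X) (hS : S.Nonempty) (N : ℕ)
    (hN : 0 < N) (hcard : S.card < 2 * N) :
    ∃ m ∈ S, (S.filter (· < m)).card < N ∧ (S.filter (m < ·)).card < N := by
  classical
  set T := S.filter (fun m => (S.filter (· < m)).card < N) with hT
  have hTne : T.Nonempty := by
    refine ⟨S.min' hS, Finset.mem_filter.2 ⟨S.min'_mem hS, ?_⟩⟩
    rw [Finset.filter_false_of_mem]
    · simpa using hN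
    · intro x hx
      exact not_lt.2 (S.min'_le x hx)
  obtain ⟨hmS, hm⟩ := Finset.mem_filter.1 (T.max'_mem hTne)
  refine ⟨T.max' hTne, hmS, hm, ?_⟩
  set m := T.max' hTne with hmdef
  by_contra! hR
  have hRne : (S.filter (m < ·)).Nonempty := Finset.card_pos.1 (by omega)
  set q := (S.filter (m < ·)).min' hRne with hq
  obtain ⟨hqS, hmq⟩ := Finset.mem_filter.1 ((S.filter (m < ·)).min'_mem hRne)
  have hsub : S.filter (· < q) ⊆ S.filter (fun x => ¬ m < x) := by
    intro x hx
    obtain ⟨hxS, hxq⟩ := Finset.mem_filter.1 hx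
    refine Finset.mem_filter.2 ⟨hxS, fun hmx => ?_⟩
    exact absurd hxq (not_lt.2 (Finset.min'_le _ _ (Finset.mem_filter.2 ⟨hxS, hmx⟩)))
  have hle := Finset.card_le_card hsub
  have hsum := Finset.card_filter_add_card_filter_not (s := S) (fun x => m < x)
  have hqT : q ∈ T := Finset.mem_filter.2 ⟨hqS, by omega⟩
  exact absurd hmq (not_lt.2 (T.le_max' q hqT))

/-- A finite subset of a linear order with fewer than `2 ^ k` elements has a monotone 2-hop
spanner with at most `k` edges per element. -/
theorem exists_monotone_two_hop {X : Type*} [LinearOrder X] (k : ℕ) :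
    ∀ S : Finset X, S.card < 2 ^ k → ∃ H : Finset (Sym2 X), H.card ≤ k * S.card ∧
      ∀ x ∈ S, ∀ y ∈ S, x ≤ y →
        ∃ z, x ≤ z ∧ z ≤ y ∧ (x = z ∨ s(x, z) ∈ H) ∧ (z = y ∨ s(z, y) ∈ H) := by
  classical
  induction k with
  | zero =>
    intro S hS
    have : S = ∅ := Finset.card_eq_zero.1 (by simpa using hS)
    subst this
    exact ⟨∅, by simp, by simp⟩
  | succ k ih =>
    intro S hS
    rcases S.eq_empty_or_nonempty with rfl | hne
    · exact ⟨∅, by simp, by simp⟩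
    obtain ⟨m, hmS, hL, hR⟩ :=
      exists_median S hne (2 ^ k) (by positivity) (by rwa [pow_succ'] at hS)
    obtain ⟨HL, hHL, hL'⟩ := ih _ hL
    obtain ⟨HR, hHR, hR'⟩ := ih _ hR
    refine ⟨HL ∪ HR ∪ S.image (fun x => s(x, m)), ?_, ?_⟩
    · have h1 := Finset.card_union_le (HL ∪ HR) (S.image (fun x => s(x, m)))
      have h2 := Finset.card_union_le HL HR
      have h3 : (S.image (fun x => s(x, m))).card ≤ S.card := Finset.card_image_le
      have h4 : (S.filter (· < m)).card + (S.filter (m < ·)).card ≤ S.card := by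
        rw [← Finset.card_union_of_disjoint]
        · exact Finset.card_le_card
            (Finset.union_subset (Finset.filter_subset _ _) (Finset.filter_subset _ _))
        · exact Finset.disjoint_filter.2 fun x _ h => not_lt.2 h.le
      have h5 := Nat.mul_le_mul_left k h4
      linarith
    · intro x hx y hy hxy
      rcases lt_or_ge y m with hym | hym
      · obtain ⟨z, h1, h2, h3, h4⟩ := hL' x (Finset.mem_filter.2 ⟨hx, hxy.trans_lt hym⟩) y
          (Finset.mem_filter.2 ⟨hy, hym⟩) hxy
        exact ⟨z, h1, h2, h3.imp_right (by simp +contextual),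
          h4.imp_right (by simp +contextual)⟩
      rcases lt_or_ge m x with hmx | hmx
      · obtain ⟨z, h1, h2, h3, h4⟩ := hR' x (Finset.mem_filter.2 ⟨hx, hmx⟩) y
          (Finset.mem_filter.2 ⟨hy, hmx.trans_le hxy⟩) hxy
        exact ⟨z, h1, h2, h3.imp_right (by simp +contextual),
          h4.imp_right (by simp +contextual)⟩
      refine ⟨m, hmx, hym, Or.inr ?_, Or.inr ?_⟩
      · exact Finset.mem_union_right _ (Finset.mem_image_of_mem _ hx)
      · rw [Sym2.eq_swap]
        exact Finset.mem_union_right _ (Finset.mem_image_of_mem (fun x => s(x, m)) hy)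

/-- A finite type with fewer than `2 ^ k` elements and a linear order relation has a monotone
2-hop spanner with at most `k` edges per element. -/
theorem exists_monotone_two_hop_of_isLinearOrder {X : Type*} [Fintype X] (r : X → X → Prop)
    (hr : IsLinearOrder X r) (k : ℕ) (hk : Fintype.card X < 2 ^ k) :
    ∃ H : Finset (Sym2 X), H.card ≤ k * Fintype.card X ∧
      ∀ x y, r x y → ∃ z, r x z ∧ r z y ∧ (x = z ∨ s(x, z) ∈ H) ∧ (z = y ∨ s(z, y) ∈ H) := by
  classical
  let _ : LinearOrder X :=
    { le := r
      le_refl := hr.refl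
      le_trans := hr.trans
      le_antisymm := hr.antisymm
      le_total := hr.total
      toDecidableLE := Classical.decRel _ }
  obtain ⟨H, hH, h⟩ := exists_monotone_two_hop k (Finset.univ : Finset X) hk
  exact ⟨H, hH, fun x y hxy => h x (Finset.mem_univ x) y (Finset.mem_univ y) hxy⟩

theorem natLog_two_add_one_le (n : ℕ) :
    ((Nat.log 2 n + 1 : ℕ) : ℝ) ≤ 2 * (1 + Real.log n) := by
  have h1 := Real.natLog_le_logb n 2
  have h2 : Real.logb 2 n ≤ 2 * Real.log n := by
    have hlog := Real.log_two_gt_d9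
    have h0 := Real.log_natCast_nonneg n
    rw [Real.logb, div_le_iff₀ (by linarith)]
    nlinarith
  push_cast at h1 ⊢
  linarith

/-- **2-hop spanner from a triangle-LSO.**  There is a universal constant `C > 0` such that
every finite metric space on `n` points admitting a `(τ, ρ)`-triangle-LSO has a 2-hop
`2ρ`-spanner with at most `C·n·τ·(1 + log n)` edges. -/
theorem two_hop_spanner_from_triangle_LSO :
    ∃ C : ℝ, 0 < C ∧
      ∀ (X : Type) [MetricSpace X] [Fintype X] (τ ρ : ℝ),
        IsTriangleLSO (fun x y : X => dist x y) τ ρ →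
        ∃ H : Finset (Sym2 X),
          (H.card : ℝ) ≤ C * Fintype.card X * τ * (1 + Real.log (Fintype.card X)) ∧
          ∀ x y : X, ∃ z : X,
            dist x z + dist z y ≤ 2 * ρ * dist x y ∧
            (x = z ∨ s(x, z) ∈ H) ∧ (z = y ∨ s(z, y) ∈ H) := by
  refine ⟨2, by norm_num, ?_⟩
  intro X _ _ τ ρ ⟨m, σ, hm, hlin, hσ⟩
  classical
  set n := Fintype.card X with hn
  choose H hcard hH using fun i => exists_monotone_two_hop_of_isLinearOrder (σ i) (hlin i)
    (Nat.log 2 n + 1) (Nat.lt_pow_succ_log_self one_lt_two n)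
  refine ⟨Finset.univ.biUnion H, ?_, ?_⟩
  · have h1 : (Finset.univ.biUnion H).card ≤ m * ((Nat.log 2 n + 1) * n) := by
      simpa using Finset.card_biUnion_le_card_mul Finset.univ H _ fun i _ => hcard i
    have hlog := natLog_two_add_one_le n
    have hlog0 := Real.log_natCast_nonneg n
    calc ((Finset.univ.biUnion H).card : ℝ)
        ≤ (m : ℝ) * (((Nat.log 2 n + 1 : ℕ) : ℝ) * n) := by exact_mod_cast h1
      _ ≤ τ * ((2 * (1 + Real.log n)) * n) := by gcongr; exact m.cast_nonneg.trans hm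
      _ = 2 * n * τ * (1 + Real.log n) := by ring
  · have hmem : ∀ i e, e ∈ H i → e ∈ Finset.univ.biUnion H := fun i e he =>
      Finset.mem_biUnion.2 ⟨i, Finset.mem_univ i, he⟩
    intro x y
    obtain ⟨i, ⟨hxy, h⟩ | ⟨hyx, h⟩⟩ := hσ x y
    · obtain ⟨z, hxz, hzy, h1, h2⟩ := hH i x y hxy
      have d1 := h x z ((hlin i).refl x) hxz hzy
      have d2 := h z y hxz hzy ((hlin i).refl y)
      exact ⟨z, by linarith, h1.imp_right (hmem i _), h2.imp_right (hmem i _)⟩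
    · obtain ⟨z, hyz, hzx, h1, h2⟩ := hH i y x hyx
      have d1 := h y z ((hlin i).refl y) hyz hzx
      have d2 := h z x hyz hzx ((hlin i).refl x)
      refine ⟨z, by rw [dist_comm x z, dist_comm z y]; linarith, ?_, ?_⟩
      · exact h2.imp Eq.symm fun he => Sym2.eq_swap ▸ hmem i _ he
      · exact h1.imp Eq.symm fun he => Sym2.eq_swap ▸ hmem i _ he
end
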